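/- Let h = 2n+1 be an odd integer with n ≥ 1 and let σ be an h-bar-core having at least five addable 0-nodes. Then every partition in P_{σ,2} has no removable 0-node. -/

import Mathlib

/-- A partition: a weakly decreasing sequence of non-negative integers with
finite sum (finitely many nonzero parts), indexed from 0 (so `parts 0` is λ₁). -/
structure BPartition where
  parts : ℕ →₀ ℕ
  antitone : ∀ r, parts (r + 1) ≤ parts r

namespace BPartition

/-- The multiset of positive parts of a partition. -/
def partsM (lam : BPartition) : Multiset ℕ :=
  lam.parts.support.val.map (fun r => lam.parts r)

/-- The Young diagram: nodes `(r, c)` with rows indexed from 0 and columns from 1. -/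
def diagram (lam : BPartition) : Set (ℕ × ℕ) :=
  {x | 1 ≤ x.2 ∧ x.2 ≤ lam.parts x.1}

/-- A partition is strict if λ_r > λ_{r+1} whenever λ_r > 0. -/
def IsStrict (lam : BPartition) : Prop :=
  ∀ r, 0 < lam.parts r → lam.parts (r + 1) < lam.parts r

/-- A partition is h-strict if each part is either strictly bigger than the next,
or positive and divisible by h, or zero. -/
def IsHStrict (h : ℕ) (lam : BPartition) : Prop :=
  ∀ r, lam.parts (r + 1) < lam.parts r ∨ (0 < lam.parts r ∧ h ∣ lam.parts r) ∨ lam.parts r = 0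

/-- An h-strict partition is restricted if for every r either λ_{r+1} > λ_r − h,
or λ_{r+1} = λ_r − h and h does not divide λ_r. -/
def IsRestricted (h : ℕ) (lam : BPartition) : Prop :=
  ∀ r, lam.parts r < lam.parts (r + 1) + h ∨
    (lam.parts (r + 1) + h = lam.parts r ∧ ¬ h ∣ lam.parts r)

/-- The residue of a node in column c (1-indexed): the smaller of the residues of
c − 1 and of −c modulo h. -/
def colRes (h c : ℕ) : ℕ := min ((c - 1) % h) ((h - c % h) % h)

/-- `x` is an addable i-node of `lam`. -/
def Addable (h i : ℕ) (lam : BPartition) (x : ℕ × ℕ) : Prop :=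
  colRes h x.2 = i ∧ x ∉ diagram lam ∧
  ∃ nu : BPartition, IsHStrict h nu ∧ diagram lam ⊆ diagram nu ∧ x ∈ diagram nu ∧
    ∀ y ∈ diagram nu, y ∉ diagram lam → colRes h y.2 = i

/-- `x` is a removable i-node of `lam`. -/
def Removable (h i : ℕ) (lam : BPartition) (x : ℕ × ℕ) : Prop :=
  x ∈ diagram lam ∧
  ∃ mu : BPartition, IsHStrict h mu ∧ diagram mu ⊆ diagram lam ∧ x ∉ diagram mu ∧
    ∀ y ∈ diagram lam, y ∉ diagram mu → colRes h y.2 = i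

/-- Removal of a single h-bar from `lam` giving `mu`, recording the value `v`:
either a part `v ≥ h` is replaced by `v − h` (deleted if `v = h`), or two parts
summing to `h` are deleted, in which case `v` is the larger of the two. -/
def barStepRec (h : ℕ) (lam mu : BPartition) (v : ℕ) : Prop :=
  IsHStrict h mu ∧
  ((v = h ∧ v ∈ partsM lam ∧ partsM mu = (partsM lam).erase v) ∨
   (h < v ∧ v ∈ partsM lam ∧ partsM mu = (v - h) ::ₘ (partsM lam).erase v) ∨
   (∃ a b : ℕ, a + b = h ∧ a ∈ partsM lam ∧ b ∈ (partsM lam).erase a ∧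
      v = max a b ∧ partsM mu = ((partsM lam).erase a).erase b))

/-- Removal of a single h-bar. -/
def barStep (h : ℕ) (lam mu : BPartition) : Prop :=
  ∃ v, barStepRec h lam mu v

/-- An h-bar-core: an h-strict partition from which no h-bar can be removed. -/
def IsBarCore (h : ℕ) (lam : BPartition) : Prop :=
  IsHStrict h lam ∧ ∀ mu, ¬ barStep h lam mu

/-- A chain of `w` h-bar removals from `lam` down to `mu`. -/
def barChain (h : ℕ) : ℕ → BPartition → BPartition → Prop
  | 0, lam, mu => lam = mu
  | w + 1, lam, mu => ∃ nu, barStep h lam nu ∧ barChain h w nu mu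

/-- `lam ∈ P_{τ,w}`: `lam` is h-strict with h-bar-core `tau` and h-bar-weight `w`. -/
def InBlock (h : ℕ) (tau : BPartition) (w : ℕ) (lam : BPartition) : Prop :=
  IsHStrict h lam ∧ IsBarCore h tau ∧ barChain h w lam tau

/-- The left-to-right order on node positions along the edge of a Young diagram:
smaller column first; within a column, larger row first. -/
def posLE (x y : ℕ × ℕ) : Prop := x.2 < y.2 ∨ (x.2 = y.2 ∧ y.1 ≤ x.1)

/-- `x` is a normal i-node: a removable i-node surviving (as a − sign) in the
reduced i-signature; equivalently, every window of the i-signature ending at `x`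
contains strictly more removable than addable i-nodes. -/
def Normal (h i : ℕ) (lam : BPartition) (x : ℕ × ℕ) : Prop :=
  Removable h i lam x ∧ ∀ z : ℕ × ℕ, posLE z x →
    Set.ncard {y | Addable h i lam y ∧ posLE z y ∧ posLE y x} <
      Set.ncard {y | Removable h i lam y ∧ posLE z y ∧ posLE y x}

/-- `x` is a conormal i-node: an addable i-node surviving (as a + sign) in the
reduced i-signature. -/
def Conormal (h i : ℕ) (lam : BPartition) (x : ℕ × ℕ) : Prop :=
  Addable h i lam x ∧ ∀ z : ℕ × ℕ, posLE x z →
    Set.ncard {y | Removable h i lam y ∧ posLE x y ∧ posLE y z} <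
      Set.ncard {y | Addable h i lam y ∧ posLE x y ∧ posLE y z}

/-- The node set of ψ_i(λ): add the leftmost s − r conormal i-nodes if s ≥ r,
remove the rightmost r − s normal i-nodes if r > s, where r = #normal and
s = #conormal i-nodes. -/
noncomputable def psiSet (h i : ℕ) (lam : BPartition) : Set (ℕ × ℕ) :=
  if Set.ncard {x | Normal h i lam x} ≤ Set.ncard {x | Conormal h i lam x} then
    diagram lam ∪ {x | Conormal h i lam x ∧
      Set.ncard {y | Conormal h i lam y ∧ posLE y x} ≤
        Set.ncard {x | Conormal h i lam x} - Set.ncard {x | Normal h i lam x}}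
  else
    diagram lam \ {x | Normal h i lam x ∧
      Set.ncard {y | Normal h i lam y ∧ posLE x y} ≤
        Set.ncard {x | Normal h i lam x} - Set.ncard {x | Conormal h i lam x}}

open Classical in
/-- The involution ψ_i. -/
noncomputable def psi (h i : ℕ) (lam : BPartition) : BPartition :=
  if hex : ∃ mu : BPartition, diagram mu = psiSet h i lam then hex.choose else lam

/-- The set of occupied positions of the abacus display of a strict partition. -/
def abacus (lam : BPartition) : Set ℤ :=
  {a | a = 0 ∨ (0 < a ∧ a.toNat ∈ partsM lam) ∨ (a < 0 ∧ (-a).toNat ∉ partsM lam)}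

/-- The dominance order: λ ⊴ μ. -/
def domLE (lam mu : BPartition) : Prop :=
  ∀ r, ∑ s ∈ Finset.range r, lam.parts s ≤ ∑ s ∈ Finset.range r, mu.parts s

/-- Strict dominance: λ ◁ μ. -/
def domLT (lam mu : BPartition) : Prop := domLE lam mu ∧ lam ≠ mu

/-- Lexicographic order: λ <lex μ. -/
def lexLT (lam mu : BPartition) : Prop :=
  ∃ r, lam.parts r < mu.parts r ∧ ∀ s < r, lam.parts s = mu.parts s

/-- Colexicographic order: λ <colex μ. -/
def colexLT (lam mu : BPartition) : Prop :=
  ∃ r, mu.parts r < lam.parts r ∧ ∀ s, r < s → lam.parts s = mu.parts s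

/-- λ ↔ᵢ μ: every node of the symmetric difference of the diagrams has residue i. -/
def Link (h i : ℕ) (lam mu : BPartition) : Prop :=
  ∀ x : ℕ × ℕ, x ∈ (diagram lam \ diagram mu) ∪ (diagram mu \ diagram lam) →
    colRes h x.2 = i

/-- `a ≤ b` are the bar positions of `lam ∈ P_{τ,2}`: the values recorded by
some two-step removal of h-bars from `lam` down to `tau`. -/
def BarPositions (h : ℕ) (tau lam : BPartition) (a b : ℕ) : Prop :=
  a ≤ b ∧ ∃ (nu : BPartition) (v₁ v₂ : ℕ), barStepRec h lam nu v₁ ∧ barStepRec h nu tau v₂ ∧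
    ({a, b} : Multiset ℕ) = {v₁, v₂}

/-- The leg length of the bar of `lam ∈ P_{τ,2}` at bar position `c`. -/
noncomputable def legLen (h : ℕ) (tau lam : BPartition) (c : ℕ) : ℕ :=
  if h ≤ c then Set.ncard {x : ℕ | c - h < x ∧ x < c ∧ x ∈ partsM lam ∧ x ∈ partsM tau}
  else (h - c) + Set.ncard {x : ℕ | h - c < x ∧ x < c ∧ x ∈ partsM lam ∧ x ∈ partsM tau}

/-- ∂λ: the absolute difference of the two leg lengths of `lam`, whose bar
positions are `a ≤ b`. -/
noncomputable def ddd (h : ℕ) (tau lam : BPartition) (a b : ℕ) : ℕ :=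
  max (legLen h tau lam a) (legLen h tau lam b) - min (legLen h tau lam a) (legLen h tau lam b)

inductive Colour | black | white | grey
deriving DecidableEq

/-- β(τ): the number of parts of τ less than h. -/
def betaCount (h : ℕ) (tau : BPartition) : ℕ :=
  Multiset.card ((partsM tau).filter (fun x => x < h))

/-- The leg length of a 2h-bar of `lam` with larger bar position `b`. -/
noncomputable def legLen2 (h : ℕ) (tau lam : BPartition) (b : ℕ) : ℕ :=
  if 2 * h ≤ b then Set.ncard {x : ℕ | b - 2 * h < x ∧ x < b ∧ x ∈ partsM lam ∧ x ∈ partsM tau}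
  else (2 * h - b) + Set.ncard {x : ℕ | 2 * h - b < x ∧ x < b ∧ x ∈ partsM lam ∧ x ∈ partsM tau}

/-- The colour of `lam ∈ P_{τ,2}` with bar positions `a ≤ b`. -/
noncomputable def colour (h : ℕ) (tau lam : BPartition) (a b : ℕ) : Colour :=
  if 2 ≤ ddd h tau lam a b then Colour.grey
  else if ddd h tau lam a b = 1 then
    if h < b then Colour.grey
    else if (min (legLen h tau lam a) (legLen h tau lam b) + betaCount h tau) % 2 = 1 then
      Colour.black else Colour.white
  else
    if b = a + h ∨ a + b = 2 * h then
      if (legLen2 h tau lam b + 2 * betaCount h tau) % 4 = 0 ∨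
         (legLen2 h tau lam b + 2 * betaCount h tau) % 4 = 3 then Colour.black
      else Colour.white
    else
      if (legLen h tau lam a + betaCount h tau) % 2 = 1 then Colour.black else Colour.white

end BPartition

namespace BPartition

theorem anti (lam : BPartition) {r s : ℕ} (hrs : r ≤ s) : lam.parts s ≤ lam.parts r :=
  antitone_nat_of_succ_le lam.antitone hrs

theorem mem_partsM (lam : BPartition) (p : ℕ) :
    p ∈ partsM lam ↔ p ≠ 0 ∧ ∃ r, lam.parts r = p := by
  unfold partsM
  simp only [Multiset.mem_map, Finset.mem_val, Finsupp.mem_support_iff]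
  constructor
  · rintro ⟨r, h1, rfl⟩
    exact ⟨h1, r, rfl⟩
  · rintro ⟨h1, r, rfl⟩
    exact ⟨r, h1, rfl⟩

theorem strict_lt {h : ℕ} {lam : BPartition} (H : IsHStrict h lam) {r s : ℕ} (hrs : r < s)
    (hd : ¬ h ∣ lam.parts r) : lam.parts s < lam.parts r := by
  have h1 := anti lam (show r + 1 ≤ s from hrs)
  rcases H r with h2 | h2 | h2
  · omega
  · exact absurd h2.2 hd
  · rw [h2] at hd; simp at hd

theorem strict_inj {h : ℕ} {lam : BPartition} (H : IsHStrict h lam) {r s : ℕ}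
    (hd : ¬ h ∣ lam.parts r) (he : lam.parts r = lam.parts s) : r = s := by
  rcases lt_trichotomy r s with h1 | h1 | h1
  · have := strict_lt H h1 hd; omega
  · exact h1
  · have := strict_lt H h1 (he ▸ hd); omega

theorem count_le {h : ℕ} {lam : BPartition} (H : IsHStrict h lam) {p : ℕ} (hd : ¬ h ∣ p) :
    (partsM lam).count p ≤ 1 := by
  unfold partsM
  rw [Multiset.count_map]
  change Multiset.card (Finset.filter (fun a => p = lam.parts a) lam.parts.support).val ≤ 1
  rw [Finset.card_val, Finset.card_le_one]
  intro a ha b hb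
  simp only [Finset.mem_filter] at ha hb
  exact strict_inj H (ha.2 ▸ hd) (ha.2.symm.trans hb.2)

theorem exists_of_multiset (h : ℕ) (M : Multiset ℕ) (h0 : 0 ∉ M)
    (hc : ∀ p, ¬ h ∣ p → M.count p ≤ 1) : ∃ mu, IsHStrict h mu ∧ partsM mu = M := by
  obtain ⟨l, hlM, hs⟩ : ∃ l : List ℕ, (l : Multiset ℕ) = M ∧ l.Pairwise (· ≥ ·) :=
    ⟨M.sort (· ≥ ·), Multiset.sort_eq M _, Multiset.pairwise_sort M _⟩
  have hget : ∀ r (hr : r < l.length), l.getD r 0 = l[r] := fun r hr => by simp [hr]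
  have hne : ∀ r (hr : r < l.length), l[r] ≠ 0 := by
    intro r hr he
    apply h0
    rw [← hlM, ← he]
    exact List.getElem_mem hr
  refine ⟨⟨Finsupp.onFinset (Finset.range l.length) (fun r => l.getD r 0) ?_, ?_⟩, ?_, ?_⟩
  · intro r hr
    by_contra hcon
    simp at hcon hr
    simp [hcon] at hr
  · intro r
    simp only [Finsupp.onFinset_apply]
    by_cases hr : r + 1 < l.length
    · rw [hget _ hr, hget r (by omega)]
      exact List.pairwise_iff_getElem.1 hs r (r+1) (by omega) hr (by omega)
    · rw [List.getD_eq_default _ _ (by omega)]; omega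
  · intro r
    simp only [Finsupp.onFinset_apply]
    by_cases hr : r + 1 < l.length
    · rw [hget _ hr, hget r (by omega)]
      have h1 := List.pairwise_iff_getElem.1 hs r (r+1) (by omega) hr (by omega)
      have h2 := hne r (by omega)
      by_contra hcon
      push Not at hcon
      have h3 : ¬ h ∣ l[r] := hcon.2.1 (by omega)
      have h4 : l[r] = l[r+1] := by omega
      have h5 := hc _ h3
      have h6 : List.Duplicate l[r] l := by
        rw [List.duplicate_iff_exists_distinct_get]
        exact ⟨⟨r, by omega⟩, ⟨r+1, hr⟩, by simp [Fin.lt_def], rfl, h4⟩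
      rw [List.duplicate_iff_two_le_count] at h6
      rw [← hlM, Multiset.coe_count] at h5
      omega
    · rw [List.getD_eq_default l _ (show l.length ≤ r + 1 by omega)]; omega
  · unfold partsM
    have hsup : (Finsupp.onFinset (Finset.range l.length) (fun r => l.getD r 0) (by
        intro r hr
        by_contra hcon
        simp at hcon hr
        simp [hcon] at hr)).support = Finset.range l.length := by
      ext r
      simp only [Finsupp.mem_support_iff, Finsupp.onFinset_apply, Finset.mem_range]
      constructor
      · intro hr
        by_contra hcon
        exact hr (List.getD_eq_default _ _ (by omega))
      · intro hr
        rw [hget r hr]; exact hne r hr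
    dsimp only
    rw [hsup]
    simp only [Finsupp.onFinset_apply]
    rw [← hlM, Finset.range_val, Multiset.range, Multiset.map_coe]
    congr 1
    apply List.ext_getElem
    · simp
    · intro i h1 h2
      simp [h2]

theorem colRes_zero {h c : ℕ} (hh : 3 ≤ h) (hc : 1 ≤ c) (H : colRes h c = 0) :
    c % h = 0 ∨ c % h = 1 := by
  unfold colRes at H
  have hlt := Nat.mod_lt c (show 0 < h by omega)
  rcases Nat.min_eq_zero_iff.1 H with h1 | h1
  · right
    have : c = (c - 1) + 1 := by omega
    rw [this, Nat.add_mod, h1, Nat.mod_eq_of_lt (show 1 < h by omega)]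
    simp [Nat.mod_eq_of_lt (show 1 < h by omega)]
  · by_contra hcon
    push Not at hcon
    rw [Nat.mod_eq_of_lt (by omega)] at h1
    omega

theorem mod_pred_zero {h c : ℕ} (hh : 3 ≤ h) (hc : (c + 1) % h = 0) : c % h = h - 1 := by
  have hlt := Nat.mod_lt c (show 0 < h by omega)
  rw [Nat.add_mod, Nat.mod_eq_of_lt (show 1 < h by omega)] at hc
  by_contra hcon
  rw [Nat.mod_eq_of_lt (by omega)] at hc
  omega

theorem mod_pred_one {h c : ℕ} (hh : 3 ≤ h) (hc : (c + 1) % h = 1) : c % h = 0 := by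
  have hlt := Nat.mod_lt c (show 0 < h by omega)
  rw [Nat.add_mod, Nat.mod_eq_of_lt (show 1 < h by omega)] at hc
  by_cases hcon : c % h = h - 1
  · rw [hcon, show h - 1 + 1 = h by omega, Nat.mod_self] at hc; omega
  · rw [Nat.mod_eq_of_lt (by omega)] at hc
    omega

theorem mod_add {h c k : ℕ} (hk : c % h + k < h) : (c + k) % h = c % h + k := by
  rw [Nat.add_mod, Nat.mod_eq_of_lt (show k < h by omega), Nat.mod_eq_of_lt hk]

section core
variable {h : ℕ} {σ : BPartition}

theorem zero_notMem (lam : BPartition) : 0 ∉ partsM lam := by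
  rw [mem_partsM]; simp

theorem core_ndvd (hh : 3 ≤ h) (hσ : IsBarCore h σ) {p : ℕ} (hp : p ∈ partsM σ) : ¬ h ∣ p := by
  intro hd
  have h0 := ((mem_partsM σ p).1 hp).1
  have hle := Nat.le_of_dvd (by omega) hd
  have hc : ∀ q, ¬ h ∣ q → ((partsM σ).erase p).count q ≤ 1 := fun q hq =>
    (Multiset.count_le_of_le _ (Multiset.erase_le _ _)).trans (count_le hσ.1 hq)
  have hz : 0 ∉ (partsM σ).erase p := fun hz => zero_notMem σ (Multiset.mem_of_mem_erase hz)
  rcases hle.eq_or_lt with he | hlt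
  · obtain ⟨mu, h1, h2⟩ := exists_of_multiset h ((partsM σ).erase p) hz hc
    exact hσ.2 mu ⟨p, h1, Or.inl ⟨he.symm, hp, h2⟩⟩
  · obtain ⟨mu, h1, h2⟩ := exists_of_multiset h ((p - h) ::ₘ (partsM σ).erase p)
      (by simp only [Multiset.mem_cons, not_or]; exact ⟨by omega, hz⟩)
      (by
        intro q hq
        rw [Multiset.count_cons_of_ne]
        · exact hc q hq
        · rintro rfl
          exact hq (Nat.dvd_sub hd (dvd_refl h)))
    exact hσ.2 mu ⟨p, h1, Or.inr (Or.inl ⟨hlt, hp, h2⟩)⟩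

theorem core_sub (hh : 3 ≤ h) (hσ : IsBarCore h σ) {p : ℕ} (hp : p ∈ partsM σ) (hlt : h < p) :
    p - h ∈ partsM σ := by
  by_contra hcon
  have hc : ∀ q, ¬ h ∣ q → ((partsM σ).erase p).count q ≤ 1 := fun q hq =>
    (Multiset.count_le_of_le _ (Multiset.erase_le _ _)).trans (count_le hσ.1 hq)
  have hz : 0 ∉ (partsM σ).erase p := fun hz => zero_notMem σ (Multiset.mem_of_mem_erase hz)
  obtain ⟨mu, h1, h2⟩ := exists_of_multiset h ((p - h) ::ₘ (partsM σ).erase p)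
      (by simp only [Multiset.mem_cons, not_or]; exact ⟨by omega, hz⟩)
      (by
        intro q hq
        rw [Multiset.count_cons]
        split_ifs with he
        · rw [he, Multiset.count_eq_zero_of_notMem
            (fun hz => hcon (Multiset.mem_of_mem_erase hz))]
        · exact hc q hq)
  exact hσ.2 mu ⟨p, h1, Or.inr (Or.inl ⟨hlt, hp, h2⟩)⟩

theorem core_pair (hh : 3 ≤ h) (hσ : IsBarCore h σ) (h1 : 1 ∈ partsM σ)
    (h2 : h - 1 ∈ partsM σ) : False := by
  have hm : h - 1 ∈ (partsM σ).erase 1 := (Multiset.mem_erase_of_ne (by omega)).2 h2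
  obtain ⟨mu, h3, h4⟩ := exists_of_multiset h (((partsM σ).erase 1).erase (h - 1))
    (fun hz => zero_notMem σ (Multiset.mem_of_mem_erase (Multiset.mem_of_mem_erase hz)))
    (fun q hq => (Multiset.count_le_of_le _ ((Multiset.erase_le _ _).trans
      (Multiset.erase_le _ _))).trans (count_le hσ.1 hq))
  exact hσ.2 mu ⟨_, h3, Or.inr (Or.inr ⟨1, h - 1, by omega, h1, hm, rfl, h4⟩)⟩

/-- descending along a runner -/
theorem core_run (hh : 3 ≤ h) (hσ : IsBarCore h σ) {t : ℕ} (ht : 0 < t) (k : ℕ) :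
    t + (k + 1) * h ∈ partsM σ → t + h ∈ partsM σ := by
  induction k with
  | zero => intro H; simpa using H
  | succ k ih =>
    intro H
    apply ih
    have := core_sub hh hσ H (by nlinarith)
    have he : t + (k + 1 + 1) * h - h = t + (k + 1) * h := by
      have : t + (k + 1 + 1) * h = t + (k + 1) * h + h := by ring
      omega
    rwa [he] at this

theorem core_run' (hh : 3 ≤ h) (hσ : IsBarCore h σ) {p : ℕ} (hp : p ∈ partsM σ) (hlt : h ≤ p) :
    p % h + h ∈ partsM σ := by
  have hd := core_ndvd hh hσ hp
  have h1 : 0 < p % h := Nat.pos_of_ne_zero (fun h => hd (Nat.dvd_of_mod_eq_zero h))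
  have h2 : 0 < p / h := Nat.div_pos hlt (by omega)
  obtain ⟨k, hk⟩ := Nat.exists_eq_succ_of_ne_zero h2.ne'
  apply core_run hh hσ h1 k
  have h3 := Nat.mod_add_div p h
  rw [hk] at h3
  rw [show p % h + (k + 1) * h = p by rw [mul_comm]; exact h3]
  exact hp

theorem core_big (hh : 3 ≤ h) (hσ : IsBarCore h σ)
    (hadd : 5 ≤ Set.ncard {x : ℕ × ℕ | Addable h 0 σ x}) : 2 * h - 1 ∈ partsM σ := by
  by_contra hcon
  have key : ∀ x, Addable h 0 σ x → (σ.parts x.1 = 0 ∧ x.2 = 1 ∧ ∀ s < x.1, σ.parts s ≠ 0) ∨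
      (σ.parts x.1 = h - 1 ∧ (x.2 = h ∨ x.2 = h + 1)) := by
    rintro ⟨r, c⟩ ⟨hres, hx, nu, hnu, hsub, hxn, hall⟩
    have hle : ∀ s, σ.parts s ≤ nu.parts s := by
      intro s
      by_contra hlt
      have : (s, σ.parts s) ∈ diagram nu := hsub ⟨by dsimp; omega, le_refl _⟩
      exact hlt this.2
    have hcol : ∀ s d, σ.parts s < d → d ≤ nu.parts s → d % h = 0 ∨ d % h = 1 := by
      intro s d h1 h2
      exact colRes_zero hh (by omega) (hall (s, d) ⟨by dsimp; omega, h2⟩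
        (fun hy => by have := hy.2; dsimp at this; omega))
    obtain ⟨hc1, hc2⟩ := hxn
    dsimp at hc1 hc2 ⊢
    have hc3 : σ.parts r < c := by
      by_contra h1
      exact hx ⟨hc1, by dsimp; omega⟩
    have htwo : ¬ (2 % h = 0 ∨ 2 % h = 1) := by
      rw [Nat.mod_eq_of_lt (show 2 < h by omega)]; omega
    by_cases h0 : σ.parts r = 0
    · left
      have hn1 : nu.parts r < 2 := by
        by_contra h2
        exact htwo (hcol r 2 (by omega) (by omega))
      refine ⟨h0, by omega, ?_⟩
      intro s hs hs0
      have hn2 : nu.parts s < 2 := by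
        by_contra h2
        exact htwo (hcol s 2 (by omega) (by omega))
      have := anti nu hs.le
      have h3 : ¬ h ∣ nu.parts s := by
        rw [show nu.parts s = 1 by omega, Nat.dvd_one]; omega
      have := strict_lt hnu hs h3
      omega
    · right
      have hmem : σ.parts r ∈ partsM σ := (mem_partsM _ _).2 ⟨h0, r, rfl⟩
      have hnd := core_ndvd hh hσ hmem
      have hm : σ.parts r % h = h - 1 := by
        rcases hcol r (σ.parts r + 1) (by omega) (by omega) with h1 | h1
        · exact mod_pred_zero hh h1
        · exact absurd (Nat.dvd_of_mod_eq_zero (mod_pred_one hh h1)) hnd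
      have hlt : σ.parts r < h := by
        by_contra hge
        have := core_run' hh hσ hmem (by omega)
        rw [hm, show h - 1 + h = 2 * h - 1 by omega] at this
        exact hcon this
      rw [Nat.mod_eq_of_lt hlt] at hm
      refine ⟨hm, ?_⟩
      by_contra h4
      have := hcol r (h + 2) (by omega) (by omega)
      rw [Nat.add_mod_left] at this
      exact htwo this
  have huniq : ∃ a b : ℕ, ∀ x, Addable h 0 σ x → x ∈ ({(a, 1), (b, h), (b, h+1)} : Finset (ℕ × ℕ)) := by
    have hA : ∃ a, ∀ r, σ.parts r = 0 → (∀ s < r, σ.parts s ≠ 0) → r = a := by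
      by_cases hex : ∃ a, σ.parts a = 0 ∧ ∀ s < a, σ.parts s ≠ 0
      · obtain ⟨a, ha, ha'⟩ := hex
        refine ⟨a, fun r hr hr' => ?_⟩
        rcases lt_trichotomy r a with h1 | h1 | h1
        · exact absurd hr (ha' r h1)
        · exact h1
        · exact absurd ha (hr' a h1)
      · exact ⟨0, fun r hr hr' => absurd ⟨r, hr, hr'⟩ hex⟩
    have hB : ∃ b, ∀ r, σ.parts r = h - 1 → r = b := by
      by_cases hex : ∃ b, σ.parts b = h - 1
      · obtain ⟨b, hb⟩ := hex
        refine ⟨b, fun r hr => strict_inj hσ.1 ?_ (hr.trans hb.symm)⟩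
        rw [hr]
        intro hd
        have := Nat.le_of_dvd (by omega) hd
        omega
      · exact ⟨0, fun r hr => absurd ⟨r, hr⟩ hex⟩
    obtain ⟨a, ha⟩ := hA
    obtain ⟨b, hb⟩ := hB
    refine ⟨a, b, ?_⟩
    rintro ⟨r, c⟩ hx
    rcases key _ hx with ⟨h1, h2, h3⟩ | ⟨h1, h2⟩
    · have := ha r h1 h3
      dsimp at h2
      simp [this, h2]
    · have := hb r h1
      dsimp at h2
      rcases h2 with h2 | h2 <;> simp [this, h2]
  obtain ⟨a, b, hab⟩ := huniq
  have h1 : Set.ncard {x : ℕ × ℕ | Addable h 0 σ x} ≤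
      Set.ncard (({(a, 1), (b, h), (b, h+1)} : Finset (ℕ × ℕ)) : Set (ℕ × ℕ)) :=
    Set.ncard_le_ncard (fun x hx => hab x hx) (Finset.finite_toSet _)
  rw [Set.ncard_coe_finset] at h1
  have := Finset.card_le_three (a := (a, 1)) (b := (b, h)) (c := (b, h+1))
  omega

end core

theorem step_cases {h : ℕ} {lam mu : BPartition} (H : barStep h lam mu) :
    partsM lam = h ::ₘ partsM mu ∨
    (∃ u R, 0 < u ∧ partsM lam = (u + h) ::ₘ R ∧ partsM mu = u ::ₘ R) ∨
    (∃ a b, a + b = h ∧ 0 < a ∧ 0 < b ∧ partsM lam = a ::ₘ b ::ₘ partsM mu) := by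
  obtain ⟨v, -, ⟨rfl, h1, h2⟩ | ⟨h1, h2, h3⟩ | ⟨a, b, h1, h2, h3, -, h4⟩⟩ := H
  · left; rw [h2, Multiset.cons_erase h1]
  · right; left
    refine ⟨v - h, _, by omega, ?_, h3⟩
    rw [Nat.sub_add_cancel h1.le, Multiset.cons_erase h2]
  · right; right
    refine ⟨a, b, h1, Nat.pos_of_ne_zero ?_, Nat.pos_of_ne_zero ?_, ?_⟩
    · rintro rfl; exact zero_notMem _ h2
    · rintro rfl; exact zero_notMem _ (Multiset.mem_of_mem_erase h3)
    · rw [h4, Multiset.cons_erase h3, Multiset.cons_erase h2]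

theorem nodup_cons {h : ℕ} {lam : BPartition} (H : IsHStrict h lam) {p : ℕ} (hd : ¬ h ∣ p)
    {R : Multiset ℕ} (hR : partsM lam = p ::ₘ R) : p ∉ R := by
  intro hp
  have h1 := count_le H hd
  rw [hR, Multiset.count_cons_self] at h1
  have := Multiset.count_pos.2 hp
  omega

theorem pair_ne {h a b : ℕ} {lam mu : BPartition} (hh : 3 ≤ h) (H : IsHStrict h lam)
    (hab : a + b = h) (hlam : partsM lam = a ::ₘ b ::ₘ partsM mu) (hm : h - 1 ∈ partsM mu) :
    a ≠ h - 1 ∧ b ≠ h - 1 := by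
  have hd : ¬ h ∣ h - 1 := fun hd => by
    have := Nat.le_of_dvd (by omega) hd
    omega
  constructor
  · rintro rfl
    exact nodup_cons H hd hlam (Multiset.mem_cons_of_mem hm)
  · rintro rfl
    rw [Multiset.cons_swap] at hlam
    exact nodup_cons H hd hlam (Multiset.mem_cons_of_mem hm)

theorem ndvd_2 {h : ℕ} (hh : 3 ≤ h) : ¬ h ∣ h - 1 + h := by
  rw [Nat.dvd_add_self_right]
  intro hd
  have := Nat.le_of_dvd (by omega) hd
  omega

theorem step1 {h : ℕ} (hh : 3 ≤ h) {σ nu : BPartition} (hnu : IsHStrict h nu)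
    (H : barStep h nu σ)
    (s0 : ∀ p ∈ partsM σ, p % h ≠ 0) (s1 : ∀ p ∈ partsM σ, p % h ≠ 1)
    (m1 : h - 1 ∈ partsM σ) (m2 : h - 1 + h ∈ partsM σ) :
    (∀ p ∈ partsM nu, p % h ≠ 1) ∧ h - 1 ∈ partsM nu ∧
    (∀ p ∈ partsM nu, p % h = 0 → p = h ∧ h - 1 + h ∈ partsM nu) := by
  rcases step_cases H with e | ⟨u, R, hu, e, e'⟩ | ⟨a, b, hab, ha, hb, e⟩
  · rw [e]
    refine ⟨?_, by simp [m1], ?_⟩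
    · intro p hp
      rcases Multiset.mem_cons.1 hp with rfl | hp
      · simp
      · exact s1 p hp
    · intro p hp h0
      rcases Multiset.mem_cons.1 hp with rfl | hp
      · exact ⟨rfl, by simp [m2]⟩
      · exact absurd h0 (s0 p hp)
  · have hR : ∀ p ∈ R, p ∈ partsM σ := fun p hp => by rw [e']; exact Multiset.mem_cons_of_mem hp
    have hU : u ∈ partsM σ := by rw [e']; simp
    rw [e]
    refine ⟨?_, ?_, ?_⟩
    · intro p hp
      rcases Multiset.mem_cons.1 hp with rfl | hp
      · rw [Nat.add_mod_right]; exact s1 _ hU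
      · exact s1 p (hR p hp)
    · rw [e'] at m1 m2
      rcases Multiset.mem_cons.1 m1 with rfl | m1
      · exfalso
        apply nodup_cons hnu (ndvd_2 hh) e
        rcases Multiset.mem_cons.1 m2 with m2 | m2
        · omega
        · exact m2
      · exact Multiset.mem_cons_of_mem m1
    · intro p hp h0
      rcases Multiset.mem_cons.1 hp with rfl | hp
      · rw [Nat.add_mod_right] at h0; exact absurd h0 (s0 _ hU)
      · exact absurd h0 (s0 p (hR p hp))
  · have hne := pair_ne hh hnu hab e m1
    rw [e]
    refine ⟨?_, by simp [m1], ?_⟩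
    · intro p hp
      simp only [Multiset.mem_cons] at hp
      rcases hp with rfl | rfl | hp
      · rw [Nat.mod_eq_of_lt (by omega)]; omega
      · rw [Nat.mod_eq_of_lt (by omega)]; omega
      · exact s1 p hp
    · intro p hp h0
      simp only [Multiset.mem_cons] at hp
      rcases hp with rfl | rfl | hp
      · rw [Nat.mod_eq_of_lt (by omega)] at h0; omega
      · rw [Nat.mod_eq_of_lt (by omega)] at h0; omega
      · exact absurd h0 (s0 p hp)

theorem step2 {h : ℕ} (hh : 3 ≤ h) {nu lam : BPartition} (hlam : IsHStrict h lam)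
    (H : barStep h lam nu)
    (s1 : ∀ p ∈ partsM nu, p % h ≠ 1) (m1 : h - 1 ∈ partsM nu)
    (s0 : ∀ p ∈ partsM nu, p % h = 0 → p = h ∧ h - 1 + h ∈ partsM nu) :
    (∀ p ∈ partsM lam, p % h ≠ 1) ∧ (∀ p ∈ partsM lam, p % h = 0 → p - 1 ∈ partsM lam) := by
  rcases step_cases H with e | ⟨u, R, hu, e, e'⟩ | ⟨a, b, hab, ha, hb, e⟩
  · rw [e]
    refine ⟨?_, ?_⟩
    · intro p hp
      rcases Multiset.mem_cons.1 hp with rfl | hp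
      · simp
      · exact s1 p hp
    · intro p hp h0
      apply Multiset.mem_cons_of_mem
      rcases Multiset.mem_cons.1 hp with rfl | hp
      · exact m1
      · rw [(s0 p hp h0).1]; exact m1
  · have hR : ∀ p ∈ R, p ∈ partsM nu := fun p hp => by rw [e']; exact Multiset.mem_cons_of_mem hp
    have hU : u ∈ partsM nu := by rw [e']; simp
    rw [e]
    refine ⟨?_, ?_⟩
    · intro p hp
      rcases Multiset.mem_cons.1 hp with rfl | hp
      · rw [Nat.add_mod_right]; exact s1 _ hU
      · exact s1 p (hR p hp)
    · intro p hp h0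
      apply Multiset.mem_cons_of_mem
      rcases Multiset.mem_cons.1 hp with rfl | hp
      · rw [Nat.add_mod_right] at h0
        obtain ⟨rfl, h2⟩ := s0 _ hU h0
        rw [e'] at h2
        rcases Multiset.mem_cons.1 h2 with h2 | h2
        · omega
        · rwa [show u + u - 1 = u - 1 + u by omega]
      · obtain ⟨rfl, m2⟩ := s0 p (hR p hp) h0
        rw [e'] at m1 m2
        rcases Multiset.mem_cons.1 m1 with rfl | m1
        · exfalso
          apply nodup_cons hlam (ndvd_2 hh) e
          rcases Multiset.mem_cons.1 m2 with m2 | m2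
          · omega
          · exact m2
        · exact m1
  · have hne := pair_ne hh hlam hab e m1
    rw [e]
    refine ⟨?_, ?_⟩
    · intro p hp
      simp only [Multiset.mem_cons] at hp
      rcases hp with rfl | rfl | hp
      · rw [Nat.mod_eq_of_lt (by omega)]; omega
      · rw [Nat.mod_eq_of_lt (by omega)]; omega
      · exact s1 p hp
    · intro p hp h0
      simp only [Multiset.mem_cons] at hp ⊢
      rcases hp with rfl | rfl | hp
      · rw [Nat.mod_eq_of_lt (by omega)] at h0; omega
      · rw [Nat.mod_eq_of_lt (by omega)] at h0; omega
      · rw [(s0 p hp h0).1]; exact Or.inr (Or.inr m1)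

theorem not_removable {h : ℕ} (hh : 3 ≤ h) {lam : BPartition}
    (s1 : ∀ p ∈ partsM lam, p % h ≠ 1)
    (s0 : ∀ p ∈ partsM lam, p % h = 0 → p - 1 ∈ partsM lam) (x : ℕ × ℕ) :
    ¬ Removable h 0 lam x := by
  obtain ⟨r, c⟩ := x
  rintro ⟨⟨hc1, hc2⟩, mu, hmu, hsub, hx, hall⟩
  dsimp at hc1 hc2
  have hle : ∀ s, mu.parts s ≤ lam.parts s := by
    intro s
    by_contra hlt
    have : (s, mu.parts s) ∈ diagram lam := hsub ⟨by dsimp; omega, le_refl _⟩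
    exact hlt this.2
  have hcol : ∀ s d, mu.parts s < d → d ≤ lam.parts s → d % h = 0 ∨ d % h = 1 := by
    intro s d h1 h2
    exact colRes_zero hh (by omega) (hall (s, d) ⟨by dsimp; omega, h2⟩
      (fun hy => by have := hy.2; dsimp at this; omega))
  have hlt : mu.parts r < c := by
    by_contra h1
    exact hx ⟨hc1, by dsimp; omega⟩
  have hmem : lam.parts r ∈ partsM lam := (mem_partsM _ _).2 ⟨by omega, r, rfl⟩
  have h0 : lam.parts r % h = 0 :=
    (hcol r _ (by omega) le_rfl).resolve_right (s1 _ hmem)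
  have hge : h ≤ lam.parts r := Nat.le_of_dvd (by omega) (Nat.dvd_of_mod_eq_zero h0)
  obtain ⟨-, s, hs⟩ := (mem_partsM _ _).1 (s0 _ hmem h0)
  have hpm : (lam.parts r - 1) % h = h - 1 :=
    mod_pred_zero hh (by rwa [Nat.sub_add_cancel (by omega)])
  have hbad : ¬ ((lam.parts r - 1) % h = 0 ∨ (lam.parts r - 1) % h = 1) := by omega
  have hrs : r < s := by
    by_contra h1
    have := anti lam (show s ≤ r by omega)
    omega
  have e1 : mu.parts r = lam.parts r - 1 := by
    by_contra h1
    exact hbad (hcol r _ (by omega) (by omega))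
  have e2 : mu.parts s = lam.parts r - 1 := by
    have := hle s
    by_contra h1
    exact hbad (hcol s _ (by omega) (by omega))
  have := strict_lt hmu hrs (by rw [e1]; intro hd; have := Nat.mod_eq_zero_of_dvd hd; omega)
  omega

end BPartition

open BPartition in
/-- If σ is an h-bar-core with at least five addable 0-nodes, then no partition in
P_{σ,2} has a removable 0-node. -/
theorem stmt9 (n h : ℕ) (hn : 1 ≤ n) (hh : h = 2 * n + 1)
    (σ : BPartition) (hσ : IsBarCore h σ)
    (hadd : 5 ≤ Set.ncard {x : ℕ × ℕ | Addable h 0 σ x}) :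
    ∀ lam, InBlock h σ 2 lam → ∀ x, ¬ Removable h 0 lam x := by
  have h3 : 3 ≤ h := by omega
  intro lam ⟨hl, _, nu, hs1, tau, hs2, he⟩
  have he' : tau = σ := he
  subst he'
  have m2 := core_big h3 hσ hadd
  have m1 := core_sub h3 hσ m2 (by omega)
  rw [show 2 * h - 1 - h = h - 1 by omega] at m1
  rw [show 2 * h - 1 = h - 1 + h by omega] at m2
  have s0 : ∀ p ∈ partsM tau, p % h ≠ 0 := fun p hp h0 =>
    core_ndvd h3 hσ hp (Nat.dvd_of_mod_eq_zero h0)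
  have s1 : ∀ p ∈ partsM tau, p % h ≠ 1 := by
    intro p hp h1
    apply core_pair h3 hσ _ m1
    by_cases hlt : p < h
    · rw [Nat.mod_eq_of_lt hlt] at h1
      rwa [h1] at hp
    · have := core_run' h3 hσ hp (by omega)
      rw [h1] at this
      have := core_sub h3 hσ this (by omega)
      rwa [Nat.add_sub_cancel] at this
  have hnu : IsHStrict h nu := by
    obtain ⟨v, hv, -⟩ := hs1
    exact hv
  obtain ⟨a1, a2, a3⟩ := step1 h3 hnu hs2 s0 s1 m1 m2
  obtain ⟨b1, b2⟩ := step2 h3 hl hs1 a1 a2 a3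
  exact fun x => not_removable h3 b1 b2 x
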